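/- Let n₁, n₂ ≥ 1 and let M¹ : Fin n₁ → Fin n₂ → ℝ and M² : Fin n₂ → Fin n₁ → ℝ be payoff matrices for players 1 and 2. Let γ₁, γ₂ ≥ 0 be risk-aversion parameters and let ε be a real number with 0 ≤ ε ≤ min (1/n₁) (1/n₂). Then there exists a pair (σ, ς) ∈ Δ_ε(n₁) × Δ_ε(n₂) such that σ maximizes the total utility r(·, ς, M¹) (with parameter γ₁) over Δ_ε(n₁) and ς maximizes the total utility r(·, σ, M²) (with parameter γ₂) over Δ_ε(n₂); that is, a risk-averse equilibrium exists. -/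

import Mathlib

open Finset

noncomputable section

/-- The ε-constrained simplex: vectors with all coordinates ≥ ε summing to 1. -/
def simplexEps (m : ℕ) (ε : ℝ) : Set (Fin m → ℝ) :=
  {σ | (∀ i, ε ≤ σ i) ∧ ∑ i, σ i = 1}

/-- Expected utility u(σ, ς, M). -/
def expUtil {m k : ℕ} (σ : Fin m → ℝ) (ς : Fin k → ℝ) (M : Fin m → Fin k → ℝ) : ℝ :=
  ∑ j, ∑ i, σ j * ς i * M j i

/-- Expected payoff of own action j against opponent mixed strategy ς: M̄ j. -/
def meanPay {m k : ℕ} (ς : Fin k → ℝ) (M : Fin m → Fin k → ℝ) (j : Fin m) : ℝ :=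
  ∑ i, ς i * M j i

/-- Entries of the ς-weighted covariance matrix Σ_{M,ς}. -/
def covEnt {m k : ℕ} (ς : Fin k → ℝ) (M : Fin m → Fin k → ℝ) (j j' : Fin m) : ℝ :=
  ∑ i, ς i * (M j i - meanPay ς M j) * (M j' i - meanPay ς M j')

/-- Utility variance Var(σ, ς, M) = σᵀ Σ_{M,ς} σ. -/
def utilVar {m k : ℕ} (σ : Fin m → ℝ) (ς : Fin k → ℝ) (M : Fin m → Fin k → ℝ) : ℝ :=
  ∑ j, ∑ j', σ j * σ j' * covEnt ς M j j'

/-- Total utility r(σ, ς, M) = u(σ, ς, M) − γ · Var(σ, ς, M). -/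
def totalUtil {m k : ℕ} (γ : ℝ) (σ : Fin m → ℝ) (ς : Fin k → ℝ)
    (M : Fin m → Fin k → ℝ) : ℝ :=
  expUtil σ ς M - γ * utilVar σ ς M

open MeasureTheory Polynomial Filter Topology

lemma LipschitzWith.exists_inv_smul {E : Type*} [NormedAddCommGroup E]
    [NormedSpace ℝ E] {v : E → E} {a : E → ℝ} {Kv Ka : NNReal}
    (hv : LipschitzWith Kv v) (ha : LipschitzWith Ka a) {c C : ℝ} (hc : 0 < c)
    (hca : ∀ x, c ≤ a x) (hva : ∀ x, ‖v x‖ ≤ C * a x) :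
    ∃ K, LipschitzWith K fun x => (a x)⁻¹ • v x := by
  refine ⟨_, LipschitzWith.of_dist_le' (K := c⁻¹ * (Kv + C * Ka)) fun x y => ?_⟩
  have hx : 0 < a x := hc.trans_le (hca x)
  have hy : 0 < a y := hc.trans_le (hca y)
  have hxc : (a x)⁻¹ ≤ c⁻¹ := inv_anti₀ hc (hca x)
  have h1 : (a x)⁻¹ • v x - (a y)⁻¹ • v y
      = (a x)⁻¹ • (v x - v y) + ((a x)⁻¹ * ((a y - a x) * (a y)⁻¹)) • v y := by
    have : (a x)⁻¹ * ((a y - a x) * (a y)⁻¹) = (a x)⁻¹ - (a y)⁻¹ := by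
      field_simp
    rw [this]
    module
  have hV : ‖v x - v y‖ ≤ Kv * ‖x - y‖ := hv.norm_sub_le x y
  have hA : |a y - a x| ≤ Ka * ‖x - y‖ := by
    rw [abs_sub_comm]
    exact ha.norm_sub_le x y
  have hvy : (a y)⁻¹ * ‖v y‖ ≤ C := by
    rw [inv_mul_le_iff₀ hy, mul_comm]
    exact hva y
  rw [dist_eq_norm, dist_eq_norm, h1]
  calc _ ≤ (a x)⁻¹ * ‖v x - v y‖ + (a x)⁻¹ * (|a y - a x| * ((a y)⁻¹ * ‖v y‖)) := by
        refine (norm_add_le _ _).trans (le_of_eq ?_)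
        simp only [norm_smul, norm_mul, norm_inv, Real.norm_eq_abs, abs_of_pos hx, abs_of_pos hy,
          mul_assoc]
    _ ≤ c⁻¹ * (Kv * ‖x - y‖) + c⁻¹ * (Ka * ‖x - y‖ * C) := by
        gcongr
    _ = c⁻¹ * (Kv + C * Ka) * ‖x - y‖ := by ring

lemma LipschitzWith.exists_smul_of_bounded {E : Type*} [NormedAddCommGroup E]
    [NormedSpace ℝ E] {l : E → ℝ} {h : E → E}
    {Kl Kh : NNReal} (hl : LipschitzWith Kl l) (hh : LipschitzWith Kh h) {A B : ℝ}
    (hA : ∀ x, |l x| ≤ A) (hB : ∀ x, ‖h x‖ ≤ B) :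
    ∃ K, LipschitzWith K fun x => l x • h x := by
  refine ⟨_, LipschitzWith.of_dist_le' (K := A * Kh + Kl * B) fun x y => ?_⟩
  have h1 : l x • h x - l y • h y = l x • (h x - h y) + (l x - l y) • h y := by module
  have hL : |l x - l y| ≤ Kl * ‖x - y‖ := hl.norm_sub_le x y
  have hA0 : 0 ≤ A := (abs_nonneg _).trans (hA x)
  rw [dist_eq_norm, dist_eq_norm, h1]
  calc _ ≤ |l x| * ‖h x - h y‖ + |l x - l y| * ‖h y‖ := by
        refine (norm_add_le _ _).trans (le_of_eq ?_)
        simp only [norm_smul, Real.norm_eq_abs]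
    _ ≤ A * (Kh * ‖x - y‖) + Kl * ‖x - y‖ * B := by
        gcongr
        · exact hA x
        · exact hh.norm_sub_le x y
        · exact hB y
    _ = _ := by ring

/-- The metric projection onto a complete convex set. -/
lemma exists_convex_projection {E : Type*} [NormedAddCommGroup E]
    [InnerProductSpace ℝ E] {s : Set E} (hne : s.Nonempty) (hs : IsComplete s)
    (hconv : Convex ℝ s) :
    ∃ P : E → E, LipschitzWith 1 P ∧ (∀ x, P x ∈ s) ∧
      ∀ x, ∀ w ∈ s, inner ℝ (x - P x) (w - P x) ≤ 0 := by
  choose P hPs hP using exists_norm_eq_iInf_of_complete_convex hne hs hconv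
  have hin : ∀ x, ∀ w ∈ s, inner ℝ (x - P x) (w - P x) ≤ 0 := fun x =>
    (norm_eq_iInf_iff_real_inner_le_zero hconv (hPs x)).1 (hP x)
  refine ⟨P, LipschitzWith.of_dist_le_mul fun x y => ?_, hPs, hin⟩
  rw [NNReal.coe_one, one_mul, dist_eq_norm, dist_eq_norm]
  have h1 := hin x (P y) (hPs y)
  have h2 := hin y (P x) (hPs x)
  have h3 : ‖P x - P y‖ ^ 2 ≤ inner ℝ (x - y) (P x - P y) := by
    rw [← real_inner_self_eq_norm_sq]
    simp only [inner_sub_left, inner_sub_right] at h1 h2 ⊢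
    linarith
  have h4 := real_inner_le_norm (x - y) (P x - P y)
  by_contra! hlt
  nlinarith [norm_nonneg (x - y)]

section Retraction

variable {E : Type*} [NormedAddCommGroup E] [InnerProductSpace ℝ E] [FiniteDimensional ℝ E]

/-- Along a line through the identity, the determinant is a polynomial function. -/
lemma exists_polynomial_eval_eq_det (A : E →L[ℝ] E) :
    ∃ p : ℝ[X], p.natDegree ≤ Module.finrank ℝ E ∧
      ∀ t : ℝ, p.eval t = (ContinuousLinearMap.id ℝ E + t • A).det := by
  classical
  let b := Module.finBasis ℝ E
  let M := LinearMap.toMatrix b b (A : E →ₗ[ℝ] E)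
  refine ⟨((X : ℝ[X]) • M.map C + (1 : Matrix _ _ ℝ).map C).det, ?_, fun t => ?_⟩
  · simpa using natDegree_det_X_add_C_le M 1
  · rw [ContinuousLinearMap.det, ← LinearMap.det_toMatrix b, ← coe_evalRingHom, RingHom.map_det]
    congr 1
    ext i j
    simp [M, LinearMap.toMatrix_apply, Matrix.one_apply, Finsupp.single_apply, eq_comm, add_comm,
      apply_ite (Polynomial.eval t)]
    ring

/-- The value at `1` of a polynomial of bounded degree is a fixed linear combination of its values
at points of `(0, δ]`. -/
lemma exists_extrapolation (n : ℕ) {δ : ℝ} (hδ : 0 < δ) :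
    ∃ (s w : ℕ → ℝ), (∀ i ∈ range (n + 1), 0 < s i ∧ s i ≤ δ) ∧
      ∀ p : ℝ[X], p.natDegree ≤ n → p.eval 1 = ∑ i ∈ range (n + 1), w i * p.eval (s i) := by
  let s : ℕ → ℝ := fun i => δ / (i + 1)
  have hs : Set.InjOn s (range (n + 1) : Finset ℕ) := by
    intro i _ j _ hij
    have : (i : ℝ) + 1 = j + 1 := by
      simp only [s] at hij
      field_simp at hij
      linarith
    exact_mod_cast add_right_cancel this
  refine ⟨s, fun i => (Lagrange.basis (range (n + 1)) s i).eval 1, fun i _ => ⟨?_, ?_⟩, ?_⟩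
  · positivity
  · exact div_le_self hδ.le (by simp)
  · intro p hp
    have hdeg : p.degree < (range (n + 1)).card := by
      rw [card_range]
      exact degree_le_natDegree.trans_lt (by exact_mod_cast Nat.lt_succ_of_le hp)
    conv_lhs => rw [Lagrange.eq_interpolate hs hdeg]
    simp [Lagrange.interpolate_apply, eval_finsetSum, mul_comm]

lemma det_id_add_pos {A : E →L[ℝ] E} (hA : ‖A‖ < 1) :
    0 < (ContinuousLinearMap.id ℝ E + A).det := by
  obtain ⟨p, -, hp⟩ := exists_polynomial_eval_eq_det A
  have hne : ∀ t ∈ Set.Icc (0 : ℝ) 1, p.eval t ≠ 0 := by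
    intro t ht h0
    rw [hp] at h0
    have hlt : ‖-(t • A)‖ < 1 := by
      rw [norm_neg, norm_smul, Real.norm_of_nonneg ht.1]
      nlinarith [norm_nonneg A, ht.2]
    have hu : IsUnit (ContinuousLinearMap.id ℝ E + t • A) := by
      simpa [ContinuousLinearMap.one_def] using isUnit_one_sub_of_norm_lt_one hlt
    have := (hu.map (ContinuousLinearMap.toLinearMapRingHom (R₁ := ℝ) (M₁ := E))).map
      (LinearMap.det (M := E) (A := ℝ))
    exact this.ne_zero h0
  have h0 : p.eval 0 = 1 := by
    rw [hp]; simp [ContinuousLinearMap.det]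
  have h1 : p.eval 1 = (ContinuousLinearMap.id ℝ E + A).det := by rw [hp, one_smul]
  rw [← h1]
  by_contra! h
  obtain ⟨t, ht, ht0⟩ := intermediate_value_Icc' zero_le_one p.continuous.continuousOn
    (show (0 : ℝ) ∈ Set.Icc (p.eval 1) (p.eval 0) from ⟨h, by rw [h0]; norm_num⟩)
  exact hne t ht ht0

variable [MeasurableSpace E] [BorelSpace E]

/-- A small multiple of a Lipschitz field supported in a ball generates a volume preserving (in the
integrated sense) perturbation of the identity on that ball. -/
lemma exists_integral_det_eq_volume_ball {k : E → E} {K : NNReal} (hk : LipschitzWith K k) {R : ℝ}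
    (hR : ∀ x, R ≤ ‖x‖ → k x = 0) :
    ∃ δ > 0, ∀ t : ℝ, 0 < t → t ≤ δ →
      IntegrableOn (fun x => (ContinuousLinearMap.id ℝ E + t • fderiv ℝ k x).det)
        (Metric.ball 0 R ∩ {x | DifferentiableAt ℝ k x}) ∧
      ∫ x in Metric.ball 0 R ∩ {x | DifferentiableAt ℝ k x},
        (ContinuousLinearMap.id ℝ E + t • fderiv ℝ k x).det
          = volume.real (Metric.ball (0 : E) R) := by
  have hdet : ENNReal.ofReal |(ContinuousLinearMap.id ℝ E).det| < (2 : NNReal) := by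
    simp [ContinuousLinearMap.det]
  obtain ⟨η, hη, hη0⟩ := ((addHaar_image_le_mul_of_det_lt (volume : Measure E)
    (ContinuousLinearMap.id ℝ E) hdet).and self_mem_nhdsWithin).exists
  have hη0 : 0 < η := hη0
  set δ : ℝ := min (η / (K + 1)) (1 / (2 * (K + 1))) with hδ
  refine ⟨δ, by positivity, fun t ht htδ => ?_⟩
  have htη : t * K ≤ η := by
    have h1 : t ≤ η / (K + 1) := htδ.trans (min_le_left _ _)
    rw [le_div_iff₀ (by positivity)] at h1
    linarith
  have htK : t * K ≤ 1 / 2 := by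
    have h1 : t ≤ 1 / (2 * (K + 1)) := htδ.trans (min_le_right _ _)
    rw [le_div_iff₀ (by positivity)] at h1
    linarith
  set U : Set E := Metric.ball 0 R
  set S : Set E := U ∩ {x | DifferentiableAt ℝ k x}
  let g : E → E := fun x => x + t • k x
  have hkt : ∀ x y, ‖t • (k x - k y)‖ ≤ t * K * ‖x - y‖ := by
    intro x y
    rw [norm_smul, Real.norm_of_nonneg ht.le, mul_assoc]
    exact mul_le_mul_of_nonneg_left (hk.norm_sub_le x y) ht.le
  have hginj : Function.Injective g := by
    intro x y hxy
    have h1 : x - y = -(t • (k x - k y)) := by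
      have : x + t • k x = y + t • k y := hxy
      rw [smul_sub, neg_sub, sub_eq_sub_iff_add_eq_add, this, add_comm]
    have h2 : ‖x - y‖ ≤ t * K * ‖x - y‖ := by
      conv_lhs => rw [h1, norm_neg]
      exact hkt x y
    have h3 : ‖x - y‖ = 0 := le_antisymm (by nlinarith [norm_nonneg (x - y)]) (norm_nonneg _)
    exact sub_eq_zero.1 (norm_eq_zero.1 h3)
  have hgsurj : Function.Surjective g := by
    intro y
    have hc : ContractingWith (1 / 2) (fun x => y - t • k x) := by
      refine ⟨by rw [← NNReal.coe_lt_coe]; norm_num, LipschitzWith.of_dist_le_mul fun x x' => ?_⟩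
      rw [dist_eq_norm, dist_eq_norm, sub_sub_sub_cancel_left, ← smul_sub]
      refine (hkt x' x).trans ?_
      rw [norm_sub_rev]
      exact mul_le_mul_of_nonneg_right (by simpa using htK) (norm_nonneg _)
    refine ⟨hc.fixedPoint, ?_⟩
    have := hc.fixedPoint_isFixedPt
    have h2 : y - t • k hc.fixedPoint = hc.fixedPoint := this
    exact (sub_eq_iff_eq_add.1 h2).symm
  have hgout : ∀ x, x ∉ U → g x = x := by
    intro x hx
    simp [g, hR x (by simpa [U] using hx)]
  have hgU : g '' U = U := by
    ext y
    constructor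
    · rintro ⟨x, hx, rfl⟩
      by_contra hy
      exact hy ((hginj (hgout _ hy)).symm ▸ hx)
    · intro hy
      obtain ⟨x, rfl⟩ := hgsurj y
      refine ⟨x, ?_, rfl⟩
      by_contra hx
      exact hx (hgout x hx ▸ hy)
  have hSm : MeasurableSet S :=
    measurableSet_ball.inter (measurableSet_of_differentiableAt ℝ k)
  have hnull : volume (U \ S) = 0 := by
    refine measure_mono_null (fun x hx => ?_) (ae_iff.1 (hk.ae_differentiableAt (μ := volume)))
    exact fun hd => hx.2 ⟨hx.1, hd⟩
  have hgnull : volume (g '' (U \ S)) = 0 := by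
    have happ : ApproximatesLinearOn g (ContinuousLinearMap.id ℝ E) (U \ S) η := by
      intro x _ y _
      have : g x - g y - ContinuousLinearMap.id ℝ E (x - y) = t • (k x - k y) := by
        simp only [g, ContinuousLinearMap.id_apply, smul_sub]
        abel
      rw [this]
      exact (hkt x y).trans (mul_le_mul_of_nonneg_right htη (norm_nonneg _))
    have := hη _ g happ
    simpa [hnull] using this
  have hvol : volume (g '' S) = volume U := by
    refine le_antisymm ((measure_mono (Set.image_mono Set.inter_subset_left)).trans_eq
      (by rw [hgU])) ?_
    calc volume U = volume (g '' S ∪ g '' (U \ S)) := by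
          rw [← Set.image_union, Set.union_sdiff_cancel Set.inter_subset_left, hgU]
      _ ≤ volume (g '' S) + volume (g '' (U \ S)) := measure_union_le _ _
      _ = volume (g '' S) := by rw [hgnull, add_zero]
  have hg' : ∀ x ∈ S, HasFDerivWithinAt g (ContinuousLinearMap.id ℝ E + t • fderiv ℝ k x) S x := by
    intro x hx
    exact ((hasFDerivAt_id x).add (hx.2.hasFDerivAt.const_smul t)).hasFDerivWithinAt
  have habs : ∀ x, |(ContinuousLinearMap.id ℝ E + t • fderiv ℝ k x).det| • (1 : ℝ)
      = (ContinuousLinearMap.id ℝ E + t • fderiv ℝ k x).det := by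
    intro x
    rw [smul_eq_mul, mul_one, abs_of_pos]
    refine det_id_add_pos ?_
    rw [norm_smul, Real.norm_of_nonneg ht.le]
    have := mul_le_mul_of_nonneg_left (norm_fderiv_le_of_lipschitz ℝ hk (x₀ := x)) ht.le
    linarith
  have hfin : volume (g '' S) ≠ ⊤ := by rw [hvol]; exact measure_ball_lt_top.ne
  constructor
  · have := (integrableOn_image_iff_integrableOn_abs_det_fderiv_smul volume hSm hg' hginj.injOn
      (fun _ => (1 : ℝ))).1 (integrableOn_const hfin)
    simpa only [habs] using this
  · have := integral_image_eq_integral_abs_det_fderiv_smul volume hSm hg' hginj.injOn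
      (fun _ => (1 : ℝ))
    simp only [habs] at this
    rw [← this]
    simp [Measure.real, hvol]

/-- There is no Lipschitz retraction of a ball onto its sphere. -/
lemma not_exists_lipschitz_retraction {k : E → E} {K : NNReal} (hk : LipschitzWith K k) {R : ℝ}
    (hRpos : 0 < R) (hR : ∀ x, R ≤ ‖x‖ → k x = 0) (hsphere : ∀ x, ‖x‖ < R → ‖x + k x‖ = R) :
    False := by
  obtain ⟨δ, hδ, hint⟩ := exists_integral_det_eq_volume_ball hk hR
  obtain ⟨s, w, hs, hw⟩ := exists_extrapolation (Module.finrank ℝ E) hδ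
  set S : Set E := Metric.ball 0 R ∩ {x | DifferentiableAt ℝ k x}
  have hSm : MeasurableSet S :=
    measurableSet_ball.inter (measurableSet_of_differentiableAt ℝ k)
  have hdet0 : ∀ x ∈ S, (ContinuousLinearMap.id ℝ E + (1 : ℝ) • fderiv ℝ k x).det = 0 := by
    rintro x ⟨hx, hd⟩
    rw [one_smul]
    set D := ContinuousLinearMap.id ℝ E + fderiv ℝ k x
    have hD : HasFDerivAt (fun y => y + k y) D x := (hasFDerivAt_id x).add hd.hasFDerivAt
    have hconst : (fun y => ‖y + k y‖ ^ 2) =ᶠ[𝓝 x] fun _ => R ^ 2 := by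
      filter_upwards [Metric.isOpen_ball.mem_nhds hx] with y hy
      rw [hsphere y (by simpa using hy)]
    have horth : ∀ v, inner ℝ (x + k x) (D v) = 0 := by
      intro v
      have h1 := hD.norm_sq.unique ((hasFDerivAt_const (R ^ 2) x).congr_of_eventuallyEq hconst)
      have := congrArg (fun L => L v) h1
      simpa [← mul_add, ← inner_add_left] using this
    by_contra hne
    have hu : IsUnit (D : E →ₗ[ℝ] E) := (LinearMap.isUnit_iff_isUnit_det _).2 (Ne.isUnit hne)
    obtain ⟨v, hv⟩ := ((Module.End.isUnit_iff _).1 hu).2 (x + k x)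
    have h2 := horth v
    rw [show D v = x + k x from hv, real_inner_self_eq_norm_sq, hsphere x (by simpa using hx)] at h2
    exact (pow_pos hRpos 2).ne' h2
  have hpt : ∀ A : E →L[ℝ] E, (ContinuousLinearMap.id ℝ E + (1 : ℝ) • A).det
      = ∑ i ∈ range (Module.finrank ℝ E + 1),
          w i * (ContinuousLinearMap.id ℝ E + s i • A).det := by
    intro A
    obtain ⟨p, hdeg, hp⟩ := exists_polynomial_eval_eq_det A
    simpa only [hp] using hw p hdeg
  have hw1 : ∑ i ∈ range (Module.finrank ℝ E + 1), w i = 1 := by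
    simpa using (hw 1 (by simp)).symm
  have hzero : ∫ x in S, (ContinuousLinearMap.id ℝ E + (1 : ℝ) • fderiv ℝ k x).det = 0 := by
    rw [setIntegral_congr_fun hSm hdet0]
    simp
  simp only [hpt] at hzero
  rw [integral_finsetSum _ fun i hi =>
    ((hint (s i) (hs i hi).1 (hs i hi).2).1.const_mul (w i))] at hzero
  simp only [integral_const_mul] at hzero
  rw [sum_congr rfl fun i hi => by rw [(hint (s i) (hs i hi).1 (hs i hi).2).2],
    ← sum_mul, hw1, one_mul] at hzero
  exact (ENNReal.toReal_pos (Metric.measure_ball_pos volume (0 : E) hRpos).ne'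
    measure_ball_lt_top.ne).ne' hzero

/-- **Brouwer's theorem** for bounded Lipschitz self-maps of a Euclidean space. -/
lemma LipschitzWith.exists_eq_of_bounded {h : E → E} {K : NNReal} (hh : LipschitzWith K h) {M : ℝ}
    (hM : ∀ x, ‖h x‖ ≤ M) : ∃ x, h x = x := by
  by_contra! hne
  have hM0 : 0 ≤ M := (norm_nonneg _).trans (hM 0)
  set R : ℝ := M + 2
  have hRpos : 0 < R := by positivity
  let l : E → ℝ := fun x => max 0 (min 1 (R - ‖x‖))
  have hl : LipschitzWith 1 l := by
    have h1 : LipschitzWith 1 fun x : E => R - ‖x‖ := by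
      simpa using (LipschitzWith.const R).sub (lipschitzWith_one_norm (E := E))
    exact (h1.const_min 1).const_max 0
  have hl0 : ∀ x, 0 ≤ l x := fun x => le_max_left _ _
  have hl1 : ∀ x, l x ≤ 1 := fun x => max_le zero_le_one (min_le_left _ _)
  let G : E → E := fun x => x - l x • h x
  obtain ⟨Ks, hs⟩ := hl.exists_smul_of_bounded hh (fun x => by
    rw [abs_of_nonneg (hl0 x)]; exact hl1 x) hM
  have hG : LipschitzWith (1 + Ks) G := LipschitzWith.id.sub hs
  have hGout : ∀ x, R ≤ ‖x‖ → G x = x := by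
    intro x hx
    have : l x = 0 := max_eq_left ((min_le_right _ _).trans (by linarith))
    simp [G, this]
  have hG0 : ∀ x, G x ≠ 0 := by
    intro x hx
    have hx' : x = l x • h x := sub_eq_zero.1 hx
    have hxM : ‖x‖ ≤ M := by
      rw [hx', norm_smul, Real.norm_of_nonneg (hl0 x)]
      exact (mul_le_of_le_one_left (norm_nonneg _) (hl1 x)).trans (hM x)
    have : l x = 1 := by
      simp only [l]
      rw [min_eq_left (by simp only [R]; linarith), max_eq_right zero_le_one]
    rw [this, one_smul] at hx'
    exact hne x hx'.symm
  obtain ⟨c, hc, hcG⟩ : ∃ c > 0, ∀ x, c ≤ ‖G x‖ := by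
    obtain ⟨x₀, -, hx₀⟩ := (isCompact_closedBall (0 : E) R).exists_isMinOn
      ⟨0, by simpa using hRpos.le⟩ hG.continuous.norm.continuousOn
    refine ⟨min ‖G x₀‖ R, lt_min (norm_pos_iff.2 (hG0 x₀)) hRpos, fun x => ?_⟩
    rcases le_total ‖x‖ R with hx | hx
    · exact (min_le_left _ _).trans (hx₀ (by simpa using hx))
    · rw [hGout x hx]
      exact (min_le_right _ _).trans hx
  obtain ⟨K₁, h₁⟩ := hG.exists_inv_smul (lipschitzWith_one_norm.comp hG) hc hcG (C := 1)
    (fun x => by simp)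
  obtain ⟨K₂, h₂⟩ := LipschitzWith.id.exists_inv_smul
    ((lipschitzWith_one_norm (E := E)).const_max R) hRpos (C := 1)
    (fun x => le_max_left _ _) (fun x => by simp)
  have hk := (lipschitzWith_smul R).comp (h₁.sub h₂)
  refine not_exists_lipschitz_retraction hk hRpos (fun x hx => ?_) fun x hx => ?_
  · simp [hGout x hx, max_eq_right hx]
  · have hGx : ‖G x‖ ≠ 0 := norm_ne_zero_iff.2 (hG0 x)
    have : x + R • (‖G x‖⁻¹ • G x - (max R ‖x‖)⁻¹ • x) = R • ‖G x‖⁻¹ • G x := by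
      rw [max_eq_left hx.le, smul_sub, smul_inv_smul₀ hRpos.ne']
      abel
    simp only [Function.comp_apply, id]
    rw [this, norm_smul, norm_smul, norm_inv, norm_norm, inv_mul_cancel₀ hGx, mul_one,
      Real.norm_of_nonneg hRpos.le]

/-- **Hartman–Stampacchia theorem** for a continuously differentiable field on a compact convex
set. -/
theorem exists_variational_inequality {s : Set E} (hne : s.Nonempty) (hs : IsCompact s)
    (hconv : Convex ℝ s) {F : E → E} (hF : ContDiff ℝ 1 F) :
    ∃ z ∈ s, ∀ w ∈ s, inner ℝ (F z) (w - z) ≤ 0 := by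
  obtain ⟨P, hPlip, hPs, hP⟩ := exists_convex_projection hne hs.isComplete hconv
  obtain ⟨L, hL⟩ :=
    (hF.locallyLipschitz.locallyLipschitzOn (s := s)).exists_lipschitzOnWith_of_compact hs
  have hFP : LipschitzWith (L * 1) fun x => F (P x) := by
    rw [← lipschitzOnWith_univ]
    exact hL.comp hPlip.lipschitzOnWith fun x _ => hPs x
  obtain ⟨M, hM⟩ := hs.isBounded.exists_norm_le
  obtain ⟨z, hz⟩ := (hPlip.comp (hPlip.add hFP)).exists_eq_of_bounded fun x => hM _ (hPs _)
  have hz' : P (P z + F (P z)) = z := hz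
  have hzs : z ∈ s := hz' ▸ hPs _
  have hPz : P z = z := by
    have := hP z z hzs
    rw [real_inner_self_nonpos] at this
    exact (sub_eq_zero.1 this).symm
  refine ⟨z, hzs, fun w hw => ?_⟩
  have := hP (P z + F (P z)) w hw
  rw [hz', hPz] at this
  simpa using this

end Retraction

section Equilibrium

variable {m k : ℕ}

lemma utilVar_nonneg {σ : Fin m → ℝ} {ς : Fin k → ℝ} (hς : ∀ i, 0 ≤ ς i)
    (M : Fin m → Fin k → ℝ) : 0 ≤ utilVar σ ς M := by
  have : utilVar σ ς M = ∑ i, ς i * (∑ j, σ j * (M j i - meanPay ς M j)) ^ 2 := by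
    simp only [pow_two, sum_mul_sum]
    simp only [utilVar, covEnt, mul_sum]
    rw [sum_comm (s := univ (α := Fin k))]
    refine sum_congr rfl fun j _ => ?_
    rw [sum_comm]
    exact sum_congr rfl fun j' _ => sum_congr rfl fun i _ => by ring
  rw [this]
  exact sum_nonneg fun i _ => mul_nonneg (hς i) (sq_nonneg _)

/-- The partial derivative of the total utility in the probability of action `j`. -/
def marginalUtil (γ : ℝ) (σ : Fin m → ℝ) (ς : Fin k → ℝ) (M : Fin m → Fin k → ℝ) (j : Fin m) : ℝ :=
  meanPay ς M j - 2 * γ * ∑ j', covEnt ς M j j' * σ j'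

lemma covEnt_comm (ς : Fin k → ℝ) (M : Fin m → Fin k → ℝ) (j j' : Fin m) :
    covEnt ς M j j' = covEnt ς M j' j :=
  sum_congr rfl fun _ _ => by ring

lemma totalUtil_sub (γ : ℝ) (σ σ' : Fin m → ℝ) (ς : Fin k → ℝ) (M : Fin m → Fin k → ℝ) :
    totalUtil γ σ' ς M - totalUtil γ σ ς M
      = ∑ j, marginalUtil γ σ ς M j * (σ' j - σ j) - γ * utilVar (fun j => σ' j - σ j) ς M := by
  have hexp : ∀ τ : Fin m → ℝ, expUtil τ ς M = ∑ j, meanPay ς M j * τ j := fun τ =>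
    sum_congr rfl fun j _ => by
      rw [meanPay, sum_mul]
      exact sum_congr rfl fun i _ => by ring
  have hsymm : ∑ j, ∑ j', σ j * σ' j' * covEnt ς M j j'
      = ∑ j, ∑ j', σ' j * σ j' * covEnt ς M j j' := by
    rw [sum_comm]
    exact sum_congr rfl fun j _ => sum_congr rfl fun j' _ => by rw [covEnt_comm]; ring
  have hvar : utilVar (fun j => σ' j - σ j) ς M = utilVar σ' ς M + utilVar σ ς M
      - 2 * ∑ j, ∑ j', σ' j * σ j' * covEnt ς M j j' := by
    have : utilVar (fun j => σ' j - σ j) ς M = utilVar σ' ς M + utilVar σ ς M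
      - ∑ j, ∑ j', σ j * σ' j' * covEnt ς M j j' - ∑ j, ∑ j', σ' j * σ j' * covEnt ς M j j' := by
      simp only [utilVar, ← sum_add_distrib, ← sum_sub_distrib]
      exact sum_congr rfl fun j _ => sum_congr rfl fun j' _ => by ring
    rw [this, hsymm]
    ring
  have hmarg : ∑ j, marginalUtil γ σ ς M j * (σ' j - σ j)
      = ∑ j, meanPay ς M j * σ' j - ∑ j, meanPay ς M j * σ j
        - 2 * γ * (∑ j, ∑ j', σ' j * σ j' * covEnt ς M j j' - utilVar σ ς M) := by
    simp only [marginalUtil, utilVar, ← sum_sub_distrib, mul_sum]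
    refine sum_congr rfl fun j _ => ?_
    rw [sub_mul, sum_mul, mul_sub]
    congr 1
    exact sum_congr rfl fun j' _ => by ring
  rw [totalUtil, totalUtil, hexp, hexp, hvar, hmarg]
  ring

lemma totalUtil_le_of_marginalUtil {γ : ℝ} (hγ : 0 ≤ γ) {σ σ' : Fin m → ℝ} {ς : Fin k → ℝ}
    (hς : ∀ i, 0 ≤ ς i) {M : Fin m → Fin k → ℝ}
    (h : ∑ j, marginalUtil γ σ ς M j * (σ' j - σ j) ≤ 0) :
    totalUtil γ σ' ς M ≤ totalUtil γ σ ς M := by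
  have h1 := totalUtil_sub γ σ σ' ς M
  have h2 := mul_nonneg hγ (utilVar_nonneg (σ := fun j => σ' j - σ j) hς M)
  linarith

lemma convex_simplexEps (m : ℕ) (ε : ℝ) : Convex ℝ (simplexEps m ε) := by
  intro x hx y hy a b ha hb hab
  refine ⟨fun i => ?_, ?_⟩
  · have h1 := mul_le_mul_of_nonneg_left (hx.1 i) ha
    have h2 := mul_le_mul_of_nonneg_left (hy.1 i) hb
    have h3 : a * ε + b * ε = ε := by rw [← add_mul, hab, one_mul]
    simp only [Pi.add_apply, Pi.smul_apply, smul_eq_mul]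
    linarith
  · simp [sum_add_distrib, ← mul_sum, hx.2, hy.2, hab]

lemma isCompact_simplexEps (m : ℕ) {ε : ℝ} (hε : 0 ≤ ε) : IsCompact (simplexEps m ε) := by
  refine (isCompact_stdSimplex ℝ (Fin m)).of_isClosed_subset ?_ fun x hx =>
    ⟨fun i => hε.trans (hx.1 i), hx.2⟩
  simp only [simplexEps, Set.ofPred_and, Set.ofPred_forall]
  exact (isClosed_iInter fun i => isClosed_le continuous_const (continuous_apply i)).inter
    (isClosed_eq (by fun_prop) continuous_const)

lemma simplexEps_nonempty {m : ℕ} (hm : 1 ≤ m) {ε : ℝ} (hε : ε ≤ 1 / (m : ℝ)) :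
    (simplexEps m ε).Nonempty := by
  have : (m : ℝ) ≠ 0 := by positivity
  exact ⟨fun _ => 1 / m, fun _ => hε, by simp [this]⟩

lemma contDiff_marginalUtil {V : Type*} [NormedAddCommGroup V] [NormedSpace ℝ V] (γ : ℝ)
    {σ : V → Fin m → ℝ} {ς : V → Fin k → ℝ} (hσ : ∀ j, ContDiff ℝ 1 fun z => σ z j)
    (hς : ∀ i, ContDiff ℝ 1 fun z => ς z i) (M : Fin m → Fin k → ℝ) (j : Fin m) :
    ContDiff ℝ 1 fun z => marginalUtil γ (σ z) (ς z) M j := by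
  unfold marginalUtil covEnt meanPay
  fun_prop

end Equilibrium

theorem rae_exists (n₁ n₂ : ℕ) (hn₁ : 1 ≤ n₁) (hn₂ : 1 ≤ n₂)
    (M₁ : Fin n₁ → Fin n₂ → ℝ) (M₂ : Fin n₂ → Fin n₁ → ℝ)
    (γ₁ γ₂ : ℝ) (hγ₁ : 0 ≤ γ₁) (hγ₂ : 0 ≤ γ₂)
    (ε : ℝ) (hε : 0 ≤ ε) (hε' : ε ≤ min (1 / (n₁ : ℝ)) (1 / (n₂ : ℝ))) :
    ∃ σ ∈ simplexEps n₁ ε, ∃ ς ∈ simplexEps n₂ ε,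
      (∀ σ' ∈ simplexEps n₁ ε, totalUtil γ₁ σ' ς M₁ ≤ totalUtil γ₁ σ ς M₁) ∧
      (∀ ς' ∈ simplexEps n₂ ε, totalUtil γ₂ ς' σ M₂ ≤ totalUtil γ₂ ς σ M₂) := by
  let σ : EuclideanSpace ℝ (Fin n₁ ⊕ Fin n₂) → Fin n₁ → ℝ := fun z j => z (Sum.inl j)
  let ς : EuclideanSpace ℝ (Fin n₁ ⊕ Fin n₂) → Fin n₂ → ℝ := fun z i => z (Sum.inr i)
  let pair : (Fin n₁ → ℝ) × (Fin n₂ → ℝ) → EuclideanSpace ℝ (Fin n₁ ⊕ Fin n₂) :=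
    fun p => WithLp.toLp 2 (Sum.elim p.1 p.2)
  have hpair : IsLinearMap ℝ pair := by
    constructor
    · intro p q
      ext (i | i) <;> simp [pair]
    · intro c p
      ext (i | i) <;> simp [pair]
  have hpairc : Continuous pair := (hpair.mk' pair).continuous_of_finiteDimensional
  let s : Set (EuclideanSpace ℝ (Fin n₁ ⊕ Fin n₂)) := pair '' (simplexEps n₁ ε ×ˢ simplexEps n₂ ε)
  have hne : s.Nonempty := ((simplexEps_nonempty hn₁ (hε'.trans (min_le_left _ _))).prod
    (simplexEps_nonempty hn₂ (hε'.trans (min_le_right _ _)))).image _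
  have hs : IsCompact s := ((isCompact_simplexEps n₁ hε).prod (isCompact_simplexEps n₂ hε)).image
    hpairc
  have hconv : Convex ℝ s :=
    ((convex_simplexEps n₁ ε).prod (convex_simplexEps n₂ ε)).is_linear_image hpair
  let F : EuclideanSpace ℝ (Fin n₁ ⊕ Fin n₂) → EuclideanSpace ℝ (Fin n₁ ⊕ Fin n₂) :=
    fun z => pair (marginalUtil γ₁ (σ z) (ς z) M₁, marginalUtil γ₂ (ς z) (σ z) M₂)
  have hF : ContDiff ℝ 1 F := by
    have hσ : ∀ j, ContDiff ℝ 1 fun z => σ z j := fun j => by fun_prop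
    have hς : ∀ i, ContDiff ℝ 1 fun z => ς z i := fun i => by fun_prop
    rw [contDiff_euclidean]
    rintro (j | i)
    · exact contDiff_marginalUtil γ₁ hσ hς M₁ j
    · exact contDiff_marginalUtil γ₂ hς hσ M₂ i
  obtain ⟨_, ⟨⟨x, y⟩, ⟨hx, hy⟩, rfl⟩, hz⟩ := exists_variational_inequality hne hs hconv hF
  have hz' : ∀ x' ∈ simplexEps n₁ ε, ∀ y' ∈ simplexEps n₂ ε,
      ∑ j, marginalUtil γ₁ x y M₁ j * (x' j - x j)
        + ∑ i, marginalUtil γ₂ y x M₂ i * (y' i - y i) ≤ 0 := by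
    intro x' hx' y' hy'
    have := hz _ ⟨(x', y'), ⟨hx', hy'⟩, rfl⟩
    simpa [PiLp.inner_apply, F, pair, σ, ς, mul_comm] using this
  refine ⟨x, hx, y, hy, fun x' hx' => ?_, fun y' hy' => ?_⟩
  · refine totalUtil_le_of_marginalUtil hγ₁ (fun i => hε.trans (hy.1 i)) ?_
    simpa using hz' x' hx' y hy
  · refine totalUtil_le_of_marginalUtil hγ₂ (fun i => hε.trans (hx.1 i)) ?_
    simpa using hz' x hx y' hy'
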